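/- Let Λ > 0 and 𝔪 ∈ ℝ. Let τ_s > 0 satisfy Λ/3 − τ_s² > 0 and Λ/3 − τ_s² + 2𝔪τ_s³ > 0, and set r = 1/τ_s. Then for all (T, R) ∈ ℝ² (representing the coordinate differentials (dt, dr)): [ −(Λr²/3 − 1 + 2𝔪/r)^(−1) R² + (Λr²/3 − 1 + 2𝔪/r) T² ] − [ −(Λr²/3 − 1)^(−1) R² + (Λr²/3 − 1) T² ] = 2𝔪 τ_s³ · [ C(τ_s) · (τ_s R)² + (T/τ_s)² ], where C(τ_s) = ( (Λ/3 − τ_s²)(Λ/3 − τ_s² + 2𝔪τ_s³) )^(−1). Moreover, C extends to a smooth (indeed rational without pole) function of τ_s on a neighborhood of τ_s = 0 with C(0) = 9/Λ². -/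

import Mathlib

/-- The coefficient function `C(τ_s) = ((Λ/3 - τ_s²)(Λ/3 - τ_s² + 2𝔪τ_s³))⁻¹`. -/
noncomputable def Ccoef (Λ m : ℝ) (τs : ℝ) : ℝ :=
  ((Λ / 3 - τs ^ 2) * (Λ / 3 - τs ^ 2 + 2 * m * τs ^ 3))⁻¹

/-- The `(t,r)`-part of the Schwarzschild–de Sitter metric differs from
that of the de Sitter metric by `2𝔪τ_s³ (C(τ_s)(τ_s R)² + (T/τ_s)²)`, where `τ_s = 1/r`;
moreover `C` is smooth near `τ_s = 0` with `C(0) = 9/Λ²`. -/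
theorem stmt_17 (Λ m τs : ℝ) (hΛ : 0 < Λ) (hτs : 0 < τs)
    (h1 : 0 < Λ / 3 - τs ^ 2) (h2 : 0 < Λ / 3 - τs ^ 2 + 2 * m * τs ^ 3)
    (r : ℝ) (hr : r = 1 / τs) :
    (∀ T R : ℝ,
      (-(Λ * r ^ 2 / 3 - 1 + 2 * m / r)⁻¹ * R ^ 2 +
          (Λ * r ^ 2 / 3 - 1 + 2 * m / r) * T ^ 2) -
        (-(Λ * r ^ 2 / 3 - 1)⁻¹ * R ^ 2 + (Λ * r ^ 2 / 3 - 1) * T ^ 2) =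
      2 * m * τs ^ 3 * (Ccoef Λ m τs * (τs * R) ^ 2 + (T / τs) ^ 2)) ∧
    Ccoef Λ m 0 = 9 / Λ ^ 2 ∧
    ∃ δ > 0, ContDiffOn ℝ (⊤ : ℕ∞) (Ccoef Λ m) (Metric.ball (0 : ℝ) δ) := by
  refine ⟨fun T R => ?_, ?_, ?_⟩
  · have hμ : Λ * r ^ 2 / 3 - 1 = (Λ / 3 - τs ^ 2) / τs ^ 2 := by
      rw [hr]; field_simp
    have hμm : Λ * r ^ 2 / 3 - 1 + 2 * m / r =
        (Λ / 3 - τs ^ 2 + 2 * m * τs ^ 3) / τs ^ 2 := by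
      rw [hμ, hr]; field_simp
    rw [hμm, hμ, Ccoef]
    obtain ⟨A, hA⟩ : ∃ A, A = Λ / 3 - τs ^ 2 := ⟨_, rfl⟩
    obtain ⟨B, hB⟩ : ∃ B, B = A + 2 * m * τs ^ 3 := ⟨_, rfl⟩
    rw [← hA] at h1 h2 ⊢
    rw [← hB] at h2 ⊢
    have hBA : 2 * m * τs ^ 3 = B - A := by rw [hB]; ring
    rw [hBA]
    field_simp
    ring
  · have hC : Ccoef Λ m 0 = ((Λ / 3) * (Λ / 3))⁻¹ := by simp [Ccoef]
    rw [hC]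
    field_simp
    norm_num
  · have hcont : Continuous fun x : ℝ =>
        (Λ / 3 - x ^ 2) * (Λ / 3 - x ^ 2 + 2 * m * x ^ 3) := by fun_prop
    have hopen := isOpen_ne.preimage hcont (t := {y : ℝ | y ≠ 0})
    obtain ⟨δ, hδ, hball⟩ := Metric.isOpen_iff.mp hopen 0 (by
      simp [hΛ.ne'])
    refine ⟨δ, hδ, ?_⟩
    unfold Ccoef
    exact ContDiffOn.inv (by fun_prop) fun x hx => hball hx
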